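/- Fix a positive integer r and positive integers d_1,…,d_r, s_1,…,s_r. Let a : ℤ → ℂ be a function such that for every vector μ̄ = (μ_1,…,μ_r) of positive integers the GM increment χ^{(d̄)}_{μ̄,s̄}(a)(m) does not depend on m, say χ^{(d̄)}_{μ̄,s̄}(a)(m) = c(μ̄) for all m ∈ ℤ. Then there exists a constant c ∈ ℂ (namely c = c((1,…,1))) such that c(μ̄) = c · μ_1^{d_1} μ_2^{d_2} ⋯ μ_r^{d_r} for every vector μ̄ of positive integers. -/

import Mathlib

/-- The backward difference operator with step `step`: `ξ ↦ ξ - B_step ξ`. -/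
def diffOp (step : ℤ) (ξ : ℤ → ℂ) : ℤ → ℂ := fun m => ξ m - ξ (m - step)

/-- The generalized multiple (GM) increment operator
`χ^{(d̄)}_{μ̄,s̄}(B) = ∏_{i=1}^r (1 - B_{μ_i}^{s_i})^{d_i}` applied to `ξ`. -/
def gmInc {r : ℕ} (d s μ : Fin r → ℕ) (ξ : ℤ → ℂ) : ℤ → ℂ :=
  ((List.ofFn fun i : Fin r => (diffOp ((μ i : ℤ) * (s i : ℤ)))^[d i]).foldr (· ∘ ·) id) ξ

/-- The backward shift `ξ ↦ B ξ` by one step, as a linear endomorphism of `ℤ → ℂ`. -/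
def backShift : Module.End ℂ (ℤ → ℂ) := LinearMap.funLeft ℂ ℂ fun m : ℤ => m - 1

theorem backShift_apply (ξ : ℤ → ℂ) (m : ℤ) : backShift ξ m = ξ (m - 1) := rfl

theorem backShift_pow_apply (n : ℕ) (ξ : ℤ → ℂ) (m : ℤ) :
    (backShift ^ n) ξ m = ξ (m - n) := by
  induction n generalizing m with
  | zero => simp
  | succ n ih =>
    rw [pow_succ', Module.End.mul_apply, backShift_apply, ih]
    congr 1
    push_cast
    ring

open Polynomial in
theorem diffOp_natCast (n : ℕ) :
    diffOp n = aeval backShift (1 - X ^ n : ℂ[X]) := by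
  ext ξ m
  simp [diffOp, backShift_pow_apply]

open Polynomial in
theorem gmInc_eq_aeval {r : ℕ} (d s μ : Fin r → ℕ) :
    gmInc d s μ = aeval backShift (∏ i, (1 - X ^ (μ i * s i) : ℂ[X]) ^ d i) := by
  induction r with
  | zero =>
    ext ξ m
    simp [gmInc]
  | succ r ih =>
    ext ξ m
    have h := congrFun (ih (fun i => d i.succ) (fun i => s i.succ) fun i => μ i.succ) ξ
    rw [Fin.prod_univ_succ, map_mul, Module.End.mul_apply, ← h, map_pow, Module.End.pow_apply,
      ← diffOp_natCast]
    simp [gmInc, List.ofFn_succ]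

open Polynomial in
theorem aeval_backShift_const (p : ℂ[X]) (z : ℂ) :
    aeval backShift p (Function.const ℤ z) = Function.const ℤ (p.eval 1 * z) := by
  have h (n : ℕ) : (backShift ^ n) (Function.const ℤ z) = Function.const ℤ z := by
    ext m
    simp [backShift_pow_apply]
  induction p using Polynomial.induction_on' with
  | add p q hp hq =>
    ext m
    simp [hp, hq, add_mul]
  | monomial n b =>
    ext m
    simp [aeval_monomial, h]

open Polynomial in
theorem prod_one_sub_X_pow_mul {r : ℕ} (d s μ : Fin r → ℕ) :
    ∏ i, (1 - X ^ (μ i * s i) : ℂ[X]) ^ d i =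
      (∏ i, (∑ j ∈ Finset.range (μ i), (X ^ s i) ^ j) ^ d i) *
        ∏ i, (1 - X ^ (1 * s i) : ℂ[X]) ^ d i := by
  rw [← Finset.prod_mul_distrib]
  refine Finset.prod_congr rfl fun i _ => ?_
  rw [← mul_pow, one_mul, geom_sum_mul_neg, ← pow_mul, mul_comm (s i)]

/-- if for every positive step vector `μ̄` the GM increment
`χ^{(d̄)}_{μ̄,s̄}(a)(m)` does not depend on `m`, say equals `c(μ̄)`, then
`c(μ̄) = c((1,…,1)) · μ_1^{d_1} ⋯ μ_r^{d_r}`. -/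
theorem gmInc_mean_value {r : ℕ} (hr : 0 < r) (d s : Fin r → ℕ)
    (hd : ∀ i, 0 < d i) (hs : ∀ i, 0 < s i)
    (a : ℤ → ℂ) (c : (Fin r → ℕ) → ℂ)
    (hc : ∀ (μ : Fin r → ℕ), (∀ i, 0 < μ i) → ∀ m : ℤ, gmInc d s μ a m = c μ) :
    ∀ (μ : Fin r → ℕ), (∀ i, 0 < μ i) →
      c μ = c (fun _ => 1) * ∏ i, ((μ i : ℂ)) ^ (d i) := by
  intro μ hμ
  have h1 : gmInc d s (fun _ => 1) a = Function.const ℤ (c fun _ => 1) :=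
    funext (hc _ fun _ => one_pos)
  rw [← hc μ hμ 0, gmInc_eq_aeval, prod_one_sub_X_pow_mul, map_mul, Module.End.mul_apply,
    ← gmInc_eq_aeval d s fun _ => 1, h1, aeval_backShift_const]
  simp [Polynomial.eval_prod, Polynomial.eval_finsetSum, mul_comm]
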